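/- Let A₁, A₂ : ℝ → ℝ and define the operator S by (S f)(x) = A₁(x) f(x+1) + A₂(x) f(x−1). Then S maps, for every n ≥ 0, every polynomial function of degree n to a polynomial function of degree at most n+1 if and only if A₁ + A₂ is a polynomial function of degree at most 1 and A₁ − A₂ is a polynomial function of degree at most 2; equivalently, if and only if there exist real numbers a₀₀, a₀₁, a₁₀, a₁₁, a₁₂ such that A₁(x) = ½[(a₁₂−a₀₁)x² + (a₁₁+a₀₁−a₀₀)x + (a₀₀+a₁₀)] and A₂(x) = ½[(a₀₁−a₁₂)x² + (a₀₀+a₀₁−a₁₁)x + (a₀₀−a₁₀)]. In particular the space of such operators S is 5-dimensional. -/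

import Mathlib

open Polynomial

/-- The S-Heun candidate operator `S = A₁ T₊ + A₂ T₋` on the discrete linear grid. -/
noncomputable def Sop (A₁ A₂ : ℝ → ℝ) (f : ℝ → ℝ) : ℝ → ℝ :=
  fun x => A₁ x * f (x + 1) + A₂ x * f (x - 1)

/-- `S` maps every polynomial function of degree `n` to a polynomial function of
degree at most `n+1`, for every `n ≥ 0`. -/
def SRaise (A₁ A₂ : ℝ → ℝ) : Prop :=
  ∀ (n : ℕ) (p : ℝ[X]), p.degree = (n : WithBot ℕ) →
    ∃ r : ℝ[X], r.degree ≤ (n : WithBot ℕ) + 1 ∧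
      ∀ x : ℝ, Sop A₁ A₂ (fun t => p.eval t) x = r.eval x

lemma sraise_fwd {A₁ A₂ : ℝ → ℝ} (h : SRaise A₁ A₂) :
    ((∃ s : ℝ[X], s.degree ≤ (1 : ℕ) ∧ ∀ x : ℝ, A₁ x + A₂ x = s.eval x) ∧
       (∃ d : ℝ[X], d.degree ≤ (2 : ℕ) ∧ ∀ x : ℝ, A₁ x - A₂ x = d.eval x)) := by
  obtain ⟨r, hr, hr'⟩ := h 0 1 (by simp)
  obtain ⟨q, hq, hq'⟩ := h 1 X (by simp)
  simp only [Sop, eval_one, eval_X, mul_one] at hr' hq'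
  have hr1 : r.degree ≤ (1 : ℕ) := by simpa using hr
  have hq1 : q.degree ≤ (2 : ℕ) := hq
  refine ⟨⟨r, hr1, hr'⟩, q - X * r, ?_, ?_⟩
  · rw [← natDegree_le_iff_degree_le] at *
    refine (natDegree_sub_le_of_le hq1 (natDegree_mul_le_of_le natDegree_X_le hr1)).trans ?_
    simp
  · intro x
    have h1 := hr' x
    have h2 := hq' x
    simp only [eval_sub, eval_mul, eval_X]
    rw [← h1, ← h2]; ring

lemma diff_deg (p : ℝ[X]) (hp : p ≠ 0) :
    (p.comp (X + C 1) - p.comp (X - C 1)).degree < (p.natDegree : WithBot ℕ) := by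
  have e1 : (p.comp (X + C 1)).natDegree = p.natDegree := by
    rw [natDegree_comp, natDegree_X_add_C, mul_one]
  have e2 : (p.comp (X - C 1)).natDegree = p.natDegree := by
    rw [natDegree_comp, natDegree_X_sub_C, mul_one]
  have l1 : (p.comp (X + C 1)).leadingCoeff = p.leadingCoeff := by
    rw [leadingCoeff_comp (by rw [natDegree_X_add_C]; norm_num), leadingCoeff_X_add_C]; simp
  have l2 : (p.comp (X - C 1)).leadingCoeff = p.leadingCoeff := by
    rw [leadingCoeff_comp (by rw [natDegree_X_sub_C]; norm_num), leadingCoeff_X_sub_C]; simp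
  have n1 : p.comp (X + C 1) ≠ 0 := by
    rw [← leadingCoeff_ne_zero, l1]; exact leadingCoeff_ne_zero.2 hp
  have n2 : p.comp (X - C 1) ≠ 0 := by
    rw [← leadingCoeff_ne_zero, l2]; exact leadingCoeff_ne_zero.2 hp
  have := degree_sub_lt_left (p := p.comp (X + C 1)) (q := p.comp (X - C 1))
    (by rw [degree_eq_natDegree n1, degree_eq_natDegree n2, e1, e2]) n1 (by rw [l1, l2])
  rwa [degree_eq_natDegree n1, e1] at this

lemma sraise_bwd {A₁ A₂ : ℝ → ℝ}
    (h : (∃ s : ℝ[X], s.degree ≤ (1 : ℕ) ∧ ∀ x : ℝ, A₁ x + A₂ x = s.eval x) ∧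
       (∃ d : ℝ[X], d.degree ≤ (2 : ℕ) ∧ ∀ x : ℝ, A₁ x - A₂ x = d.eval x)) :
    SRaise A₁ A₂ := by
  obtain ⟨⟨s, hs, hs'⟩, d, hd, hd'⟩ := h
  intro n p hp
  have hp0 : p ≠ 0 := by rintro rfl; simp at hp
  have hn : p.natDegree = n := natDegree_eq_of_degree_eq_some hp
  have hD := diff_deg p hp0
  have e1 : (p.comp (X + C 1)).natDegree ≤ n := by
    rw [natDegree_comp, natDegree_X_add_C, mul_one, hn]
  have e2 : (p.comp (X - C 1)).natDegree ≤ n := by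
    rw [natDegree_comp, natDegree_X_sub_C, mul_one, hn]
  rw [hn] at hD
  refine ⟨C (1/2) * (s * (p.comp (X + C 1) + p.comp (X - C 1))
    + d * (p.comp (X + C 1) - p.comp (X - C 1))), ?_, ?_⟩
  · have key : ∀ D : ℝ[X], D.degree < (n : WithBot ℕ) → (d * D).natDegree ≤ n + 1 := by
      intro D hD
      by_cases h0 : D = 0
      · simp [h0]
      · have h1 : D.natDegree < n := (natDegree_lt_iff_degree_lt h0).2 hD
        have := natDegree_mul_le_of_le (natDegree_le_iff_degree_le.2 hd) (le_refl D.natDegree)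
        omega
    have k1 := key _ hD
    have k2 : (s * (p.comp (X + C 1) + p.comp (X - C 1))).natDegree ≤ n + 1 := by
      have := natDegree_mul_le_of_le (natDegree_le_iff_degree_le.2 hs)
        (natDegree_add_le_of_degree_le e1 e2)
      omega
    have k3 := (natDegree_C_mul_le (1/2 : ℝ) _).trans (natDegree_add_le_of_degree_le k2 k1)
    have := natDegree_le_iff_degree_le.1 k3
    exact_mod_cast this
  · intro x
    have h1 := hs' x
    have h2 := hd' x
    simp only [Sop, eval_mul, eval_add, eval_sub, eval_C, eval_comp, eval_X]
    rw [← h1, ← h2]; ring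

lemma poly_iff (A₁ A₂ : ℝ → ℝ) :
    ((∃ s : ℝ[X], s.degree ≤ (1 : ℕ) ∧ ∀ x : ℝ, A₁ x + A₂ x = s.eval x) ∧
       (∃ d : ℝ[X], d.degree ≤ (2 : ℕ) ∧ ∀ x : ℝ, A₁ x - A₂ x = d.eval x)) ↔
      (∃ a₀₀ a₀₁ a₁₀ a₁₁ a₁₂ : ℝ, ∀ x : ℝ,
        A₁ x = (1/2) * ((a₁₂ - a₀₁) * x^2 + (a₁₁ + a₀₁ - a₀₀) * x + (a₀₀ + a₁₀)) ∧
        A₂ x = (1/2) * ((a₀₁ - a₁₂) * x^2 + (a₀₀ + a₀₁ - a₁₁) * x + (a₀₀ - a₁₀))) := by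
  constructor
  · rintro ⟨⟨s, hs, hs'⟩, d, hd, hd'⟩
    refine ⟨s.coeff 0, s.coeff 1, d.coeff 0, d.coeff 1 + s.coeff 0, d.coeff 2 + s.coeff 1, ?_⟩
    intro x
    have h1 := hs' x
    have h2 := hd' x
    rw [eval_eq_sum_range' (n := 2)
      (Nat.lt_succ_of_le (natDegree_le_iff_degree_le.2 hs))] at h1
    rw [eval_eq_sum_range' (n := 3)
      (Nat.lt_succ_of_le (natDegree_le_iff_degree_le.2 hd))] at h2
    simp only [Finset.sum_range_succ, Finset.sum_range_zero, pow_zero, pow_one] at h1 h2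
    constructor <;> linarith
  · rintro ⟨a, b, c, e, f, h⟩
    refine ⟨⟨C b * X + C a, degree_linear_le, ?_⟩,
      C (f - b) * X ^ 2 + C (e - a) * X + C c, degree_quadratic_le, ?_⟩ <;>
    · intro x
      rw [(h x).1, (h x).2]
      simp
      ring

/-- The parametrization. -/
noncomputable def Phi : (Fin 5 → ℝ) →ₗ[ℝ] (ℝ → ℝ) × (ℝ → ℝ) where
  toFun c :=
    (fun x => (1/2) * ((c 4 - c 1) * x^2 + (c 3 + c 1 - c 0) * x + (c 0 + c 2)),
     fun x => (1/2) * ((c 1 - c 4) * x^2 + (c 0 + c 1 - c 3) * x + (c 0 - c 2)))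
  map_add' c d := by
    ext x <;> simp <;> ring
  map_smul' r c := by
    ext x <;> simp <;> ring

lemma Phi_inj : Function.Injective Phi := by
  rw [← LinearMap.ker_eq_bot, LinearMap.ker_eq_bot']
  intro c hc
  have h1 : ∀ x : ℝ,
      (1/2) * ((c 4 - c 1) * x^2 + (c 3 + c 1 - c 0) * x + (c 0 + c 2)) = 0 :=
    fun x => congrFun (congrArg Prod.fst hc) x
  have h2 : ∀ x : ℝ,
      (1/2) * ((c 1 - c 4) * x^2 + (c 0 + c 1 - c 3) * x + (c 0 - c 2)) = 0 :=
    fun x => congrFun (congrArg Prod.snd hc) x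
  have a0 := h1 0
  have a1 := h1 1
  have a2 := h1 (-1)
  have b0 := h2 0
  have b1 := h2 1
  have b2 := h2 (-1)
  ext i
  fin_cases i <;> simp <;> linarith

theorem stmt_0 (A₁ A₂ : ℝ → ℝ) :
    (SRaise A₁ A₂ ↔
      ((∃ s : ℝ[X], s.degree ≤ (1 : ℕ) ∧ ∀ x : ℝ, A₁ x + A₂ x = s.eval x) ∧
       (∃ d : ℝ[X], d.degree ≤ (2 : ℕ) ∧ ∀ x : ℝ, A₁ x - A₂ x = d.eval x))) ∧
    (SRaise A₁ A₂ ↔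
      (∃ a₀₀ a₀₁ a₁₀ a₁₁ a₁₂ : ℝ, ∀ x : ℝ,
        A₁ x = (1/2) * ((a₁₂ - a₀₁) * x^2 + (a₁₁ + a₀₁ - a₀₀) * x + (a₀₀ + a₁₀)) ∧
        A₂ x = (1/2) * ((a₀₁ - a₁₂) * x^2 + (a₀₀ + a₀₁ - a₁₁) * x + (a₀₀ - a₁₀)))) ∧
    Module.finrank ℝ
      ↥(Submodule.span ℝ {P : (ℝ → ℝ) × (ℝ → ℝ) | SRaise P.1 P.2}) = 5 := by
  have H : ∀ A₁ A₂ : ℝ → ℝ, SRaise A₁ A₂ ↔ _ := fun A₁ A₂ => ⟨sraise_fwd, sraise_bwd⟩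
  refine ⟨H A₁ A₂, (H A₁ A₂).trans (poly_iff A₁ A₂), ?_⟩
  have hset : {P : (ℝ → ℝ) × (ℝ → ℝ) | SRaise P.1 P.2} = (LinearMap.range Phi : Set _) := by
    ext P
    rw [Set.mem_setOf_eq, H, poly_iff]
    constructor
    · rintro ⟨a, b, c, e, f, h⟩
      refine ⟨![a, b, c, e, f], ?_⟩
      ext x
      · exact ((h x).1).symm
      · exact ((h x).2).symm
    · rintro ⟨c, rfl⟩
      exact ⟨c 0, c 1, c 2, c 3, c 4, fun x => ⟨rfl, rfl⟩⟩
  rw [hset, Submodule.span_eq, LinearMap.finrank_range_of_inj Phi_inj]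
  simp
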